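/- Let d, r be positive integers, let A ∈ Matrix (Fin d) (Fin d) ℝ be symmetric, define the homogeneous quadratic Hamiltonian H(z) = (1/2) zᵀ A z, let S : ℝ^d → Matrix (Fin d) (Fin d) ℝ satisfy S(w)ᵀ = −S(w) for all w, let μ ∈ ℝ, and let V ∈ Matrix (Fin d) (Fin r) ℝ have orthonormal columns (Vᵀ V = 1). If z_r : ℝ → ℝ^r is differentiable and satisfies the reduced damped skew-gradient system z_r'(t) = Vᵀ S(V z_r(t)) V · Vᵀ A V z_r(t) − μ z_r(t) for all t ∈ ℝ, then the Hamiltonian of the reconstructed trajectory dissipates at the exact exponential rate: H(V z_r(t)) = e^{−2μt} · H(V z_r(0)) for all t ∈ ℝ. -/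

import Mathlib

open Matrix

/-- The quadratic form of a skew-symmetric real matrix vanishes. -/
theorem dotProduct_mulVec_self_eq_zero_of_transpose_eq_neg {n : Type*} [Fintype n]
    {J : Matrix n n ℝ} (hJ : Jᵀ = -J) (x : n → ℝ) : x ⬝ᵥ J *ᵥ x = 0 := by
  have h : x ⬝ᵥ J *ᵥ x = -(x ⬝ᵥ J *ᵥ x) := by
    conv_lhs => rw [dotProduct_mulVec, ← mulVec_transpose, hJ, neg_mulVec, neg_dotProduct,
      dotProduct_comm]
  linarith

/-- Derivative of the quadratic form of a symmetric matrix along a curve. -/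
theorem HasDerivAt.dotProduct_mulVec_self {n : Type*} [Fintype n]
    {B : Matrix n n ℝ} (hB : B.IsSymm) {x : ℝ → n → ℝ} {x' : n → ℝ} {t : ℝ}
    (hx : HasDerivAt x x' t) :
    HasDerivAt (fun s => x s ⬝ᵥ B *ᵥ x s) (2 * (x' ⬝ᵥ B *ᵥ x t)) t := by
  have hi := hasDerivAt_pi.mp hx
  have hBx : ∀ i, HasDerivAt (fun s => (B *ᵥ x s) i) ((B *ᵥ x') i) t := fun i =>
    HasDerivAt.fun_sum fun j _ => (hi j).const_mul (B i j)
  have h : HasDerivAt (fun s => x s ⬝ᵥ B *ᵥ x s)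
      (∑ i, (x' i * (B *ᵥ x t) i + x t i * (B *ᵥ x') i)) t :=
    HasDerivAt.fun_sum fun i _ => (hi i).mul (hBx i)
  have hsymm : x t ⬝ᵥ B *ᵥ x' = x' ⬝ᵥ B *ᵥ x t := by
    rw [dotProduct_mulVec, ← mulVec_transpose, hB.eq, dotProduct_comm]
  refine h.congr_deriv ?_
  rw [Finset.sum_add_distrib]
  change x' ⬝ᵥ B *ᵥ x t + x t ⬝ᵥ B *ᵥ x' = _
  rw [hsymm, two_mul]

/-- The solution of the scalar linear equation `f' = c f` is `f t = exp (c t) f 0`. -/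
theorem eq_exp_mul_of_hasDerivAt {f : ℝ → ℝ} {c : ℝ}
    (hf : ∀ t, HasDerivAt f (c * f t) t) (t : ℝ) : f t = Real.exp (c * t) * f 0 := by
  have hg : ∀ s, HasDerivAt (fun s => Real.exp (-(c * s)) * f s) 0 s := fun s => by
    refine (((hasDerivAt_id s).const_mul c).neg.exp.mul (hf s)).congr_deriv ?_
    simp only [Pi.neg_apply, id_eq]
    ring
  have h := is_const_of_deriv_eq_zero (fun s => (hg s).differentiableAt)
    (fun s => (hg s).deriv) t 0
  simp only [mul_zero, neg_zero, Real.exp_zero, one_mul] at h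
  rw [← h, ← mul_assoc, ← Real.exp_add, add_neg_cancel, Real.exp_zero, one_mul]

/-- The structure-preserving Galerkin reduced-order model of a damped
skew-gradient system with homogeneous quadratic Hamiltonian `H(z) = (1/2) zᵀAz`
dissipates the Hamiltonian of the reconstructed trajectory at the exact
exponential rate `e^{−2μt}`. -/
theorem reduced_damped_skew_gradient_dissipation
    (d r : ℕ) (hd : 0 < d) (hr : 0 < r)
    (A : Matrix (Fin d) (Fin d) ℝ) (hA : A.IsSymm)
    (H : (Fin d → ℝ) → ℝ)
    (hH : ∀ z, H z = (1/2) * (z ⬝ᵥ A.mulVec z))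
    (S : (Fin d → ℝ) → Matrix (Fin d) (Fin d) ℝ)
    (hS : ∀ w, (S w)ᵀ = -(S w))
    (μ : ℝ)
    (V : Matrix (Fin d) (Fin r) ℝ) (hV : Vᵀ * V = 1)
    (zr : ℝ → Fin r → ℝ) (hzr : Differentiable ℝ zr)
    (hode : ∀ t : ℝ, deriv zr t =
      (Vᵀ * S (V.mulVec (zr t)) * V).mulVec ((Vᵀ * A * V).mulVec (zr t)) - μ • zr t) :
    ∀ t : ℝ, H (V.mulVec (zr t)) = Real.exp (-2*μ*t) * H (V.mulVec (zr 0)) := by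
  have hB : (Vᵀ * A * V).IsSymm := by
    simp [Matrix.IsSymm, transpose_mul, hA.eq, Matrix.mul_assoc]
  have hJ : ∀ w, (Vᵀ * S w * V)ᵀ = -(Vᵀ * S w * V) := fun w => by
    simp [transpose_mul, hS, Matrix.mul_assoc]
  have hHV : ∀ x, H (V *ᵥ x) = (1/2) * (x ⬝ᵥ (Vᵀ * A * V) *ᵥ x) := fun x => by
    rw [hH, ← mulVec_mulVec, ← mulVec_mulVec, dotProduct_mulVec x, vecMul_transpose]
  refine eq_exp_mul_of_hasDerivAt (f := fun t => H (V *ᵥ zr t)) fun t => ?_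
  simp only [hHV]
  refine (((hzr t).hasDerivAt.dotProduct_mulVec_self hB).const_mul (1/2 : ℝ)).congr_deriv ?_
  rw [hode, sub_dotProduct, smul_dotProduct, dotProduct_comm (_ *ᵥ _),
    dotProduct_mulVec_self_eq_zero_of_transpose_eq_neg (hJ _), smul_eq_mul]
  ring
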